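/- Let f ∈ F_mon±^d and r ∈ ℕ, and let f_r = Σ_{α: λ(α)<r} f̃(α)ψ_α be the truncated Haar expansion of f, which equals the average of f on each of the 2^{rd} dyadic subcubes of side 2^{−r}. Then ‖f − sgn∘f_r‖_{L1} ≤ d·2^{−r} and ‖sgn∘f_r − f_r‖_{L2}² ≤ d·2^{−r} (with the convention sgn(0):=1). -/

import Mathlib

open MeasureTheory
open scoped ENNReal NNReal

noncomputable section

/-- The unit cube `[0,1]^d`. -/
def unitCube (d : ℕ) : Set (Fin d → ℝ) := Set.Icc 0 1

/-- The class of monotone functions `f : [0,1]^d → [-1,1]`. -/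
def FMon (d : ℕ) : Set ((Fin d → ℝ) → ℝ) :=
  {f | (∀ x ∈ unitCube d, f x ∈ Set.Icc (-1 : ℝ) 1) ∧
       (∀ x ∈ unitCube d, ∀ y ∈ unitCube d, x ≤ y → f x ≤ f y)}

/-- The class of sign-valued monotone functions `f : [0,1]^d → {-1,+1}`. -/
def FMonPM (d : ℕ) : Set ((Fin d → ℝ) → ℝ) :=
  {f | f ∈ FMon d ∧ ∀ x ∈ unitCube d, f x = -1 ∨ f x = 1}

/-- The (extended-real-valued) `L₁([0,1]^d)` distance between two functions. -/
def dist1e {d : ℕ} (g f : (Fin d → ℝ) → ℝ) : ℝ≥0∞ :=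
  ∫⁻ x in unitCube d, ENNReal.ofReal |g x - f x|

/-- The dyadic interval `I_{λ,κ} = [κ2^{-λ}, (κ+1)2^{-λ})`, closed at the right end
for the last one (`κ = 2^λ - 1`). -/
def dyadicI (lam kap : ℕ) : Set ℝ :=
  if kap + 1 = 2 ^ lam then Set.Icc ((kap : ℝ) / 2 ^ lam) 1
  else Set.Ico ((kap : ℝ) / 2 ^ lam) (((kap : ℝ) + 1) / 2 ^ lam)

/-- One-dimensional Haar functions: `ψ₀ = 1_{[0,1]}` and, for `α = 2^λ + κ ≥ 1`,
`ψ_α = 2^{λ/2}(1_{I_{λ+1,2κ+1}} - 1_{I_{λ+1,2κ}})`. -/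
def haar1 (α : ℕ) : ℝ → ℝ :=
  if α = 0 then (Set.Icc (0 : ℝ) 1).indicator 1
  else fun x =>
    Real.sqrt (2 ^ Nat.log 2 α) *
      ((dyadicI (Nat.log 2 α + 1) (2 * (α - 2 ^ Nat.log 2 α) + 1)).indicator 1 x -
        (dyadicI (Nat.log 2 α + 1) (2 * (α - 2 ^ Nat.log 2 α))).indicator 1 x)

/-- The tensor-product Haar function `ψ_α(x) = ∏_j ψ_{α_j}(x_j)`. -/
def haar {d : ℕ} (α : Fin d → ℕ) (x : Fin d → ℝ) : ℝ :=
  ∏ j, haar1 (α j) (x j)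

/-- The Haar wavelet coefficient `f̃(α) = ⟨ψ_α, f⟩`. -/
def wcoef {d : ℕ} (f : (Fin d → ℝ) → ℝ) (α : Fin d → ℕ) : ℝ :=
  ∫ x in unitCube d, haar α x * f x

/-- The number of active variables `|α|₀ = #{j : α_j > 0}`. -/
def activeCount {d : ℕ} (α : Fin d → ℕ) : ℕ :=
  (Finset.univ.filter (fun j => α j ≠ 0)).card

/-- The sign function, with the convention `sgn 0 = 1`. -/
def sgn (t : ℝ) : ℝ := if 0 ≤ t then 1 else -1

/-- The truncated Haar expansion `f_r = Σ_{α : λ(α) < r} f̃(α) ψ_α`; the indices `α ∈ ℕ₀`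
of level `< r` are exactly those with `α < 2^r`. -/
def truncExp {d : ℕ} (f : (Fin d → ℝ) → ℝ) (r : ℕ) : (Fin d → ℝ) → ℝ :=
  fun x => ∑ α : Fin d → Fin (2 ^ r),
    wcoef f (fun j => (α j : ℕ)) * haar (fun j => (α j : ℕ)) x

/-- The distribution of `n` i.i.d. points uniformly distributed on `[0,1]^d`. -/
def sampleMeasure (d n : ℕ) : Measure (Fin n → (Fin d → ℝ)) :=
  Measure.pi (fun _ => volume.restrict (unitCube d))

/-- The linear reconstruction `A_{n,k,r}`: all Haar coefficients with at most `k` active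
variables and level `< r` are estimated by standard Monte Carlo from the samples
`ξ_1, …, ξ_n`. -/
def linAlg (d n k r : ℕ) (ξ : Fin n → (Fin d → ℝ)) (f : (Fin d → ℝ) → ℝ) :
    (Fin d → ℝ) → ℝ :=
  fun x => ∑ α ∈ Finset.univ.filter
      (fun α : Fin d → Fin (2 ^ r) => activeCount (fun j => (α j : ℕ)) ≤ k),
    ((n : ℝ)⁻¹ * ∑ i, haar (fun j => (α j : ℕ)) (ξ i) * f (ξ i)) *
      haar (fun j => (α j : ℕ)) x

/-- The sign-valued reconstruction `Â_{n,k,r} = sgn ∘ A_{n,k,r}`. -/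
def hatAlg (d n k r : ℕ) (ξ : Fin n → (Fin d → ℝ)) (f : (Fin d → ℝ) → ℝ) :
    (Fin d → ℝ) → ℝ :=
  fun x => sgn (linAlg d n k r ξ f x)

/-- The general method `Ā_{n,k,r}(f) = (1/2)∫_{-1}^{1} Â_{n,k,r}(f_t) dt`, where
`f_t = sgn(f - t)`. -/
def barAlg (d n k r : ℕ) (ξ : Fin n → (Fin d → ℝ)) (f : (Fin d → ℝ) → ℝ) :
    (Fin d → ℝ) → ℝ :=
  fun x => (1 / 2) * ∫ t in (-1 : ℝ)..1, hatAlg d n k r ξ (fun y => sgn (f y - t)) x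


/-- A set of grid points no two of which are strictly ordered in every coordinate
has at most `d N^{d-1}` elements: it meets every diagonal at most once. -/
theorem card_le_of_forall_not_lt {d N : ℕ} (hd : 1 ≤ d) (B : Finset (Fin d → Fin N))
    (hB : ∀ k ∈ B, ∀ l ∈ B, ¬ ∀ j, k j < l j) : B.card ≤ d * N ^ (d - 1) := by
  classical
  have hne : (Finset.univ : Finset (Fin d)).Nonempty := ⟨⟨0, hd⟩, Finset.mem_univ _⟩
  let m : (Fin d → Fin N) → ℕ := fun k => Finset.univ.inf' hne fun j => (k j : ℕ)
  have hm : ∀ k j, m k ≤ (k j : ℕ) := fun k j =>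
    Finset.inf'_le (fun j => (k j : ℕ)) (Finset.mem_univ j)
  have hm' : ∀ k, ∃ j, m k = (k j : ℕ) := fun k => by
    obtain ⟨j, -, hj⟩ := Finset.exists_mem_eq_inf' hne fun j => (k j : ℕ)
    exact ⟨j, hj⟩
  let g : (Fin d → Fin N) → Fin d → Fin N := fun k j =>
    ⟨(k j : ℕ) - m k, (Nat.sub_le _ _).trans_lt (k j).isLt⟩
  have hg : ∀ k j, ((g k j : Fin N) : ℕ) = (k j : ℕ) - m k := fun k j => rfl
  let F : Fin d → Finset (Fin d → Fin N) := fun j =>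
    Fintype.piFinset fun i => if i = j then Finset.univ.filter (fun a : Fin N => (a : ℕ) = 0)
      else Finset.univ
  have hinj : Set.InjOn g B := by
    intro k hk l hl hkl
    have h : ∀ j, (k j : ℕ) - m k = (l j : ℕ) - m l := fun j => by
      rw [← hg, ← hg, hkl]
    rcases lt_trichotomy (m k) (m l) with hlt | heq | hgt
    · refine absurd (fun j => ?_) (hB k hk l hl)
      have := h j; have := hm k j; have := hm l j
      exact Fin.lt_def.2 (by omega)
    · ext j
      have := h j; have := hm k j; have := hm l j
      omega
    · refine absurd (fun j => ?_) (hB l hl k hk)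
      have := h j; have := hm k j; have := hm l j
      exact Fin.lt_def.2 (by omega)
  have hmaps : ∀ k ∈ B, g k ∈ Finset.univ.biUnion F := by
    intro k _
    obtain ⟨j, hj⟩ := hm' k
    refine Finset.mem_biUnion.2 ⟨j, Finset.mem_univ j, Fintype.mem_piFinset.2 fun i => ?_⟩
    by_cases hij : i = j
    · subst hij
      simp [hg, hj]
    · simp [hij]
  have hF : ∀ j, (F j).card ≤ N ^ (d - 1) := by
    intro j
    have h1 : (Finset.univ.filter (fun a : Fin N => (a : ℕ) = 0)).card ≤ 1 :=
      Finset.card_le_one.2 fun a ha b hb => Fin.ext (by simp_all)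
    rw [Fintype.card_piFinset, ← Finset.mul_prod_erase _ _ (Finset.mem_univ j)]
    have h2 : ∀ i ∈ Finset.univ.erase j, (if i = j then
        Finset.univ.filter (fun a : Fin N => (a : ℕ) = 0) else Finset.univ).card = N := by
      intro i hi
      simp [Finset.ne_of_mem_erase hi]
    rw [Finset.prod_congr rfl h2, Finset.prod_const, Finset.card_erase_of_mem (Finset.mem_univ j)]
    simpa using Nat.mul_le_mul_right (N ^ (d - 1)) h1
  calc B.card ≤ (Finset.univ.biUnion F).card := Finset.card_le_card_of_injOn g hmaps hinj
    _ ≤ (Finset.univ : Finset (Fin d)).card * N ^ (d - 1) :=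
      Finset.card_biUnion_le_card_mul _ _ _ fun j _ => hF j
    _ = d * N ^ (d - 1) := by simp

theorem mem_dyadicI {r k : ℕ} (hk : k < 2 ^ r) {x : ℝ} :
    x ∈ dyadicI r k ↔ (k : ℝ) ≤ x * 2 ^ r ∧ x ≤ 1 ∧ (k + 1 < 2 ^ r → x * 2 ^ r < k + 1) := by
  have hN : (0 : ℝ) < 2 ^ r := by positivity
  unfold dyadicI
  split_ifs with h
  · rw [Set.mem_Icc, div_le_iff₀ hN]
    exact ⟨fun hx => ⟨hx.1, hx.2, fun h' => absurd h h'.ne⟩, fun hx => ⟨hx.1, hx.2.1⟩⟩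
  · have hlt : k + 1 < 2 ^ r := by omega
    rw [Set.mem_Ico, div_le_iff₀ hN, lt_div_iff₀ hN]
    refine ⟨fun hx => ⟨hx.1, ?_, fun _ => hx.2⟩, fun hx => ⟨hx.1, hx.2.2 hlt⟩⟩
    have : (k : ℝ) + 1 < 2 ^ r := by exact_mod_cast hlt
    nlinarith [hx.2]

theorem lt_of_mem_dyadicI {r k l : ℕ} (hkl : k < l) (hl : l < 2 ^ r) {x y : ℝ}
    (hx : x ∈ dyadicI r k) (hy : y ∈ dyadicI r l) : x < y := by
  have h1 := ((mem_dyadicI (hkl.trans hl)).1 hx).2.2 (by omega)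
  have h2 := ((mem_dyadicI hl).1 hy).1
  have h3 : (k : ℝ) + 1 ≤ l := by exact_mod_cast hkl
  exact lt_of_mul_lt_mul_right (by linarith) (by positivity : (0 : ℝ) ≤ 2 ^ r)

theorem eq_of_mem_dyadicI {r k l : ℕ} (hk : k < 2 ^ r) (hl : l < 2 ^ r) {x : ℝ}
    (hx : x ∈ dyadicI r k) (hx' : x ∈ dyadicI r l) : k = l := by
  rcases lt_trichotomy k l with h | h | h
  · exact absurd (lt_of_mem_dyadicI h hl hx hx') (lt_irrefl x)
  · exact h
  · exact absurd (lt_of_mem_dyadicI h hk hx' hx) (lt_irrefl x)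

theorem dyadicI_subset {r k : ℕ} (hk : k < 2 ^ r) : dyadicI r k ⊆ Set.Icc 0 1 := by
  intro x hx
  have h := (mem_dyadicI hk).1 hx
  exact ⟨nonneg_of_mul_nonneg_left ((Nat.cast_nonneg k).trans h.1) (by positivity), h.2.1⟩

theorem exists_mem_dyadicI (r : ℕ) {x : ℝ} (hx : x ∈ Set.Icc (0 : ℝ) 1) :
    ∃ k : Fin (2 ^ r), x ∈ dyadicI r k := by
  have hN : (0 : ℝ) < 2 ^ r := by positivity
  have hN' : 0 < 2 ^ r := by positivity
  have h0 : 0 ≤ x * 2 ^ r := mul_nonneg hx.1 hN.le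
  by_cases h : x * 2 ^ r < 2 ^ r
  · have hk : ⌊x * 2 ^ r⌋₊ < 2 ^ r := (Nat.floor_lt h0).2 (by exact_mod_cast h)
    exact ⟨⟨_, hk⟩, (mem_dyadicI hk).2
      ⟨Nat.floor_le h0, hx.2, fun _ => Nat.lt_floor_add_one _⟩⟩
  · have hk : 2 ^ r - 1 < 2 ^ r := by omega
    refine ⟨⟨_, hk⟩, (mem_dyadicI hk).2 ⟨?_, hx.2, fun h' => by omega⟩⟩
    have : ((2 ^ r - 1 : ℕ) : ℝ) ≤ 2 ^ r := by exact_mod_cast Nat.sub_le _ _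
    linarith

theorem measurableSet_dyadicI (r k : ℕ) : MeasurableSet (dyadicI r k) := by
  unfold dyadicI
  split_ifs
  · exact measurableSet_Icc
  · exact measurableSet_Ico

theorem volume_dyadicI (r k : ℕ) : volume (dyadicI r k) = ENNReal.ofReal ((2 ^ r)⁻¹) := by
  have hN : (2 ^ r : ℝ) ≠ 0 := by positivity
  unfold dyadicI
  split_ifs with h
  · have h' : (k : ℝ) + 1 = 2 ^ r := by exact_mod_cast h
    rw [Real.volume_Icc, ← h']
    congr 1
    rw [← h'] at hN
    field_simp
    ring
  · rw [Real.volume_Ico]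
    congr 1
    field_simp
    ring

theorem indicator_dyadicI_eq_add {r k : ℕ} (hk : k < 2 ^ r) (x : ℝ) :
    (dyadicI r k).indicator (1 : ℝ → ℝ) x =
      (dyadicI (r + 1) (2 * k)).indicator 1 x + (dyadicI (r + 1) (2 * k + 1)).indicator 1 x := by
  have hk0 : 2 * k < 2 ^ (r + 1) := by rw [pow_succ]; omega
  have hk1 : 2 * k + 1 < 2 ^ (r + 1) := by rw [pow_succ]; omega
  have hiff : x ∈ dyadicI r k ↔
      x ∈ dyadicI (r + 1) (2 * k) ∨ x ∈ dyadicI (r + 1) (2 * k + 1) := by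
    have e : x * 2 ^ (r + 1) = 2 * (x * 2 ^ r) := by ring
    have e1 : 2 * k + 1 + 1 < 2 ^ (r + 1) ↔ k + 1 < 2 ^ r := by rw [pow_succ]; omega
    rw [mem_dyadicI hk, mem_dyadicI hk0, mem_dyadicI hk1, e, e1]
    push_cast
    constructor
    · rintro ⟨h1, h2, h3⟩
      by_cases hlt : 2 * (x * 2 ^ r) < 2 * k + 1
      · exact Or.inl ⟨by linarith, h2, fun _ => hlt⟩
      · exact Or.inr ⟨by linarith, h2, fun h => by linarith [h3 h]⟩
    · rintro (⟨h1, h2, h3⟩ | ⟨h1, h2, h3⟩)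
      · exact ⟨by linarith, h2, fun _ => by linarith [h3 hk1]⟩
      · exact ⟨by linarith, h2, fun h => by linarith [h3 h]⟩
  by_cases h0 : x ∈ dyadicI (r + 1) (2 * k)
  · have h1 : x ∉ dyadicI (r + 1) (2 * k + 1) := fun h1 => by
      have := eq_of_mem_dyadicI hk0 hk1 h0 h1
      omega
    simp [hiff, h0, h1]
  · by_cases h1 : x ∈ dyadicI (r + 1) (2 * k + 1) <;> simp [hiff, h0, h1]

theorem sum_range_two_mul {M : Type*} [AddCommMonoid M] (g : ℕ → M) (n : ℕ) :
    ∑ k ∈ Finset.range (2 * n), g k = ∑ k ∈ Finset.range n, (g (2 * k) + g (2 * k + 1)) := by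
  induction n with
  | zero => simp
  | succ n ih =>
    rw [Finset.sum_range_succ, ← ih, Nat.mul_succ, Finset.sum_range_succ, Finset.sum_range_succ,
      add_assoc]

/-- The reproducing kernel of the one-dimensional Haar functions of level less than `r`. -/
theorem sum_haar1_mul_haar1 (r : ℕ) (x y : ℝ) :
    ∑ α ∈ Finset.range (2 ^ r), haar1 α x * haar1 α y =
      2 ^ r * ∑ k ∈ Finset.range (2 ^ r),
        (dyadicI r k).indicator 1 x * (dyadicI r k).indicator 1 y := by
  induction r with
  | zero => simp [haar1, dyadicI]
  | succ r ih =>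
    have hlevel : ∀ κ ∈ Finset.range (2 ^ r), haar1 (2 ^ r + κ) x * haar1 (2 ^ r + κ) y =
        2 ^ r * (((dyadicI (r + 1) (2 * κ + 1)).indicator 1 x -
          (dyadicI (r + 1) (2 * κ)).indicator 1 x) *
          ((dyadicI (r + 1) (2 * κ + 1)).indicator 1 y -
          (dyadicI (r + 1) (2 * κ)).indicator 1 y)) := by
      intro κ hκ
      have hκ' := Finset.mem_range.1 hκ
      have hpos : 0 < 2 ^ r := by positivity
      have hlog : Nat.log 2 (2 ^ r + κ) = r :=
        Nat.log_eq_of_pow_le_of_lt_pow (by omega) (by rw [pow_succ]; omega)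
      have hne : 2 ^ r + κ ≠ 0 := by omega
      have hs : √(2 ^ r : ℝ) * √(2 ^ r) = 2 ^ r := Real.mul_self_sqrt (by positivity)
      simp only [haar1, hne, if_false, hlog, Nat.add_sub_cancel_left]
      rw [mul_mul_mul_comm, hs]
    rw [pow_succ 2 r, mul_two, Finset.sum_range_add, ih, Finset.sum_congr rfl hlevel, ← mul_two,
      mul_comm (2 ^ r) 2, sum_range_two_mul, ← Finset.mul_sum, ← mul_add,
      ← Finset.sum_add_distrib, pow_succ, mul_assoc, Finset.mul_sum _ _ (2 : ℝ)]
    congr 1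
    refine Finset.sum_congr rfl fun k hk => ?_
    have hk' := Finset.mem_range.1 hk
    rw [indicator_dyadicI_eq_add hk' x, indicator_dyadicI_eq_add hk' y]
    ring

/-- The dyadic subcube of side `2^{-r}` with index `k`. -/
def dyadicCell {d r : ℕ} (k : Fin d → Fin (2 ^ r)) : Set (Fin d → ℝ) :=
  Set.univ.pi fun j => dyadicI r (k j)

theorem measurableSet_dyadicCell {d r : ℕ} (k : Fin d → Fin (2 ^ r)) :
    MeasurableSet (dyadicCell k) :=
  MeasurableSet.univ_pi fun _ => measurableSet_dyadicI _ _

theorem volume_dyadicCell {d r : ℕ} (k : Fin d → Fin (2 ^ r)) :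
    volume (dyadicCell k) = ENNReal.ofReal (((2 ^ r) ^ d)⁻¹) := by
  rw [dyadicCell, volume_pi_pi]
  simp only [volume_dyadicI, Finset.prod_const, Finset.card_univ, Fintype.card_fin]
  rw [← ENNReal.ofReal_pow (by positivity), inv_pow]

theorem dyadicCell_subset {d r : ℕ} (k : Fin d → Fin (2 ^ r)) : dyadicCell k ⊆ unitCube d :=
  fun _ hx => ⟨fun j => (dyadicI_subset (k j).isLt (hx j trivial)).1,
    fun j => (dyadicI_subset (k j).isLt (hx j trivial)).2⟩

theorem unitCube_subset_iUnion_dyadicCell (d r : ℕ) :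
    unitCube d ⊆ ⋃ k : Fin d → Fin (2 ^ r), dyadicCell k := by
  intro x hx
  choose k hk using fun j => exists_mem_dyadicI r (x := x j) ⟨hx.1 j, hx.2 j⟩
  exact Set.mem_iUnion.2 ⟨k, fun j _ => hk j⟩

theorem sum_haar_mul_haar {d r : ℕ} {k : Fin d → Fin (2 ^ r)} {x : Fin d → ℝ}
    (hx : x ∈ dyadicCell k) (y : Fin d → ℝ) :
    ∑ α : Fin d → Fin (2 ^ r), haar (fun j => (α j : ℕ)) y * haar (fun j => (α j : ℕ)) x =
      (2 ^ r) ^ d * (dyadicCell k).indicator 1 y := by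
  have h1 : ∀ j, ∑ a : Fin (2 ^ r), haar1 a (y j) * haar1 a (x j) =
      2 ^ r * (dyadicI r (k j)).indicator 1 (y j) := by
    intro j
    rw [Fin.sum_univ_eq_sum_range (fun a => haar1 a (y j) * haar1 a (x j)),
      sum_haar1_mul_haar1, Finset.sum_eq_single (k j : ℕ)]
    · simp [Set.indicator_of_mem (hx j trivial)]
    · intro l hl hne
      rw [Set.indicator_of_notMem (a := x j), mul_zero]
      exact fun h => hne (eq_of_mem_dyadicI (Finset.mem_range.1 hl) (k j).isLt h (hx j trivial))
    · intro h
      exact absurd (Finset.mem_range.2 (k j).isLt) h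
  simp only [haar, ← Finset.prod_mul_distrib]
  rw [← Fintype.prod_sum fun j (a : Fin (2 ^ r)) => haar1 a (y j) * haar1 a (x j)]
  simp only [h1, Finset.prod_mul_distrib, Finset.prod_const, Finset.card_univ, Fintype.card_fin]
  congr 1
  by_cases hy : y ∈ dyadicCell k
  · rw [Set.indicator_of_mem hy]
    exact Finset.prod_eq_one fun j _ => Set.indicator_of_mem (hy j trivial) _
  · rw [Set.indicator_of_notMem hy]
    simp only [dyadicCell, Set.mem_pi, Set.mem_univ, true_imp_iff, not_forall] at hy
    obtain ⟨j, hj⟩ := hy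
    exact Finset.prod_eq_zero (Finset.mem_univ j) (Set.indicator_of_notMem hj _)

theorem measurable_haar1 (α : ℕ) : Measurable (haar1 α) := by
  unfold haar1
  split_ifs
  · exact measurable_one.indicator measurableSet_Icc
  · exact ((measurable_one.indicator (measurableSet_dyadicI _ _)).sub
      (measurable_one.indicator (measurableSet_dyadicI _ _))).const_mul _

theorem measurable_haar {d : ℕ} (α : Fin d → ℕ) : Measurable (haar α) :=
  Finset.measurable_fun_prod _ fun j _ => (measurable_haar1 (α j)).comp (measurable_pi_apply j)

theorem abs_haar1_le (α : ℕ) (x : ℝ) : |haar1 α x| ≤ √(2 ^ Nat.log 2 α) := by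
  have hind : ∀ (s : Set ℝ), 0 ≤ s.indicator (1 : ℝ → ℝ) x ∧ s.indicator (1 : ℝ → ℝ) x ≤ 1 :=
    fun s => ⟨Set.indicator_nonneg (fun _ _ => zero_le_one) x,
      Set.indicator_le_self' (fun _ _ => zero_le_one) x⟩
  unfold haar1
  split_ifs with h
  · subst h
    have h0 := hind (Set.Icc 0 1)
    simpa [abs_of_nonneg h0.1] using h0.2
  · rw [abs_mul, abs_of_nonneg (Real.sqrt_nonneg _)]
    refine mul_le_of_le_one_right (Real.sqrt_nonneg _) (abs_le.2 ?_)
    have h0 := hind (dyadicI (Nat.log 2 α + 1) (2 * (α - 2 ^ Nat.log 2 α)))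
    have h1 := hind (dyadicI (Nat.log 2 α + 1) (2 * (α - 2 ^ Nat.log 2 α) + 1))
    constructor <;> linarith [h0.1, h0.2, h1.1, h1.2]

theorem abs_haar_le {d : ℕ} (α : Fin d → ℕ) (x : Fin d → ℝ) :
    |haar α x| ≤ ∏ j, √(2 ^ Nat.log 2 (α j)) := by
  rw [haar, Finset.abs_prod]
  exact Finset.prod_le_prod (fun _ _ => abs_nonneg _) fun j _ => abs_haar1_le _ _

/-- The truncated Haar expansion averages `f` over the dyadic subcubes. -/
theorem truncExp_eq_average {d r : ℕ} {f : (Fin d → ℝ) → ℝ} (hf : IntegrableOn f (unitCube d))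
    {k : Fin d → Fin (2 ^ r)} {x : Fin d → ℝ} (hx : x ∈ dyadicCell k) :
    truncExp f r x = (2 ^ r) ^ d * ∫ y in dyadicCell k, f y := by
  have hint : ∀ α : Fin d → ℕ, Integrable (fun y => haar α y * f y)
      (volume.restrict (unitCube d)) := fun α =>
    hf.bdd_mul (measurable_haar α).aestronglyMeasurable
      (Filter.Eventually.of_forall fun y => abs_haar_le α y)
  simp only [truncExp, wcoef, ← integral_mul_const]
  rw [← integral_finsetSum _ fun α _ => (hint _).mul_const _]
  have hk : ∀ y, ∑ α : Fin d → Fin (2 ^ r),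
      haar (fun j => (α j : ℕ)) y * f y * haar (fun j => (α j : ℕ)) x =
      (2 ^ r) ^ d * (dyadicCell k).indicator f y := by
    intro y
    have h : ∀ α : Fin d → Fin (2 ^ r),
        haar (fun j => (α j : ℕ)) y * f y * haar (fun j => (α j : ℕ)) x =
        haar (fun j => (α j : ℕ)) y * haar (fun j => (α j : ℕ)) x * f y := fun α => by ring
    rw [Finset.sum_congr rfl fun α _ => h α, ← Finset.sum_mul, sum_haar_mul_haar hx y, mul_assoc]
    by_cases hy : y ∈ dyadicCell k <;> simp [hy]
  simp only [hk]
  rw [integral_const_mul, setIntegral_indicator (measurableSet_dyadicCell k),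
    Set.inter_eq_self_of_subset_right (dyadicCell_subset k)]

theorem integrableOn_of_mem_FMonPM {d : ℕ} {f : (Fin d → ℝ) → ℝ} (hf : f ∈ FMonPM d) :
    IntegrableOn f (unitCube d) := by
  let S : Set (Fin d → ℝ) := {x | x ∈ unitCube d ∧ f x = 1}
  have hS : S.OrdConnected := by
    refine ⟨fun a ha b hb x hx => ?_⟩
    have hxc : x ∈ unitCube d := ⟨ha.1.1.trans hx.1, hx.2.trans hb.1.2⟩
    refine ⟨hxc, le_antisymm (hf.1.1 x hxc).2 ?_⟩
    rw [← ha.2]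
    exact hf.1.2 a ha.1 x hxc hx.1
  have hcube : MeasurableSet (unitCube d) := measurableSet_Icc
  have hfin : volume (unitCube d) ≠ ∞ := isCompact_Icc.measure_ne_top
  have hind : IntegrableOn (fun x => 2 * S.indicator (1 : (Fin d → ℝ) → ℝ) x - 1)
      (unitCube d) := by
    have : IsFiniteMeasure (volume.restrict (unitCube d)) := ⟨by
      simpa using hfin.lt_top⟩
    have h1 : Integrable (1 : (Fin d → ℝ) → ℝ) (volume.restrict (unitCube d)) :=
      integrable_const 1
    exact ((h1.indicator₀ (hS.nullMeasurableSet.mono_ac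
      Measure.restrict_le_self.absolutelyContinuous)).const_mul 2).sub h1
  refine hind.congr_fun (fun x hx => ?_) hcube
  rcases hf.2 x hx with h | h
  · have : x ∉ S := fun hx' => by linarith [hx'.2]
    simp [this, h]
  · have : x ∈ S := ⟨hx, h⟩
    norm_num [this, h]

theorem abs_sub_sgn_eq {t : ℝ} (ht : t = -1 ∨ t = 1) (a : ℝ) : |t - sgn a| = 1 - sgn a * t := by
  unfold sgn
  rcases ht with rfl | rfl <;> split_ifs <;> norm_num

theorem sgn_mul_self (a : ℝ) : sgn a * a = |a| := by
  unfold sgn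
  split_ifs with h
  · rw [abs_of_nonneg h, one_mul]
  · rw [abs_of_neg (not_le.1 h), neg_one_mul]

theorem sq_sgn_sub_le_one {a : ℝ} (ha : |a| ≤ 1) : (sgn a - a) ^ 2 ≤ 1 := by
  have h := abs_le.1 ha
  unfold sgn
  split_ifs <;> nlinarith [h.1, h.2]

theorem sgn_of_eq_neg_one_or_one {t : ℝ} (ht : t = -1 ∨ t = 1) : sgn t = t := by
  unfold sgn
  rcases ht with rfl | rfl <;> norm_num

section SignedAverage

variable {X : Type*} [MeasurableSpace X] {μ : Measure X} {Q : Set X} {f : X → ℝ} {V : ℝ}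

theorem abs_mul_setIntegral_le_one (hV : 0 < V) (hQ : μ Q = ENNReal.ofReal V⁻¹)
    (hf : ∀ x ∈ Q, f x = -1 ∨ f x = 1) : |V * ∫ x in Q, f x ∂μ| ≤ 1 := by
  have h : ‖∫ x in Q, f x ∂μ‖ ≤ 1 * μ.real Q := by
    refine norm_setIntegral_le_of_norm_le_const (by simp [hQ]) fun x hx => ?_
    rcases hf x hx with h | h <;> simp [h]
  rw [Measure.real, hQ, ENNReal.toReal_ofReal (by positivity), one_mul, Real.norm_eq_abs] at h
  rw [abs_mul, abs_of_pos hV]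
  calc V * |∫ x in Q, f x ∂μ| ≤ V * V⁻¹ := by gcongr
    _ = 1 := mul_inv_cancel₀ hV.ne'

/-- Replacing a sign-valued function by the sign of its average costs at most the measure of
the domain in `L₁`. -/
theorem setLIntegral_abs_sub_sgn_le (hV : 0 < V) (hQm : MeasurableSet Q)
    (hQ : μ Q = ENNReal.ofReal V⁻¹) (hf : ∀ x ∈ Q, f x = -1 ∨ f x = 1)
    (hfi : IntegrableOn f Q μ) :
    ∫⁻ x in Q, ENNReal.ofReal |f x - sgn (V * ∫ y in Q, f y ∂μ)| ∂μ ≤ μ Q := by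
  set a := V * ∫ y in Q, f y ∂μ with ha
  have hone : IntegrableOn (fun _ => (1 : ℝ)) Q μ := integrableOn_const (by simp [hQ])
  have hint : IntegrableOn (fun x => 1 - sgn a * f x) Q μ := hone.sub (hfi.const_mul _)
  have hcongr : Set.EqOn (fun x => ENNReal.ofReal |f x - sgn a|)
      (fun x => ENNReal.ofReal (1 - sgn a * f x)) Q := fun x hx => by
    simp only [abs_sub_sgn_eq (hf x hx) a]
  have hnn : 0 ≤ᵐ[μ.restrict Q] fun x => 1 - sgn a * f x :=
    (ae_restrict_iff' hQm).2 (Filter.Eventually.of_forall fun x hx => by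
      simp only [Pi.zero_apply, ← abs_sub_sgn_eq (hf x hx) a]
      exact abs_nonneg _)
  rw [setLIntegral_congr_fun hQm hcongr, ← ofReal_integral_eq_lintegral_ofReal hint hnn,
    integral_sub hone (hfi.const_mul _), integral_const_mul, hQ]
  have hQr : ∫ _ in Q, (1 : ℝ) ∂μ = V⁻¹ := by
    rw [setIntegral_const, Measure.real, hQ, ENNReal.toReal_ofReal (by positivity), smul_eq_mul,
      mul_one]
  have hI : ∫ y in Q, f y ∂μ = V⁻¹ * a := by
    rw [ha, inv_mul_cancel_left₀ hV.ne']
  rw [hQr, hI, mul_left_comm, sgn_mul_self]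
  refine ENNReal.ofReal_le_ofReal (sub_le_self _ ?_)
  positivity

end SignedAverage

/-- An integral over the cube of a function that vanishes on the dyadic subcubes where `f` is
constant, and has integral at most the volume on each of the others, is at most `d 2^{-r}`. -/
theorem setLIntegral_unitCube_le {d r : ℕ} (hd : 1 ≤ d) {f : (Fin d → ℝ) → ℝ} (hf : f ∈ FMonPM d)
    {G : (Fin d → ℝ) → ℝ≥0∞}
    (hconst : ∀ (k : Fin d → Fin (2 ^ r)) (c : ℝ), (∀ x ∈ dyadicCell k, f x = c) →
      ∀ x ∈ dyadicCell k, G x = 0)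
    (hle : ∀ k : Fin d → Fin (2 ^ r), ∫⁻ x in dyadicCell k, G x ≤ volume (dyadicCell k)) :
    ∫⁻ x in unitCube d, G x ≤ ENNReal.ofReal ((d : ℝ) / 2 ^ r) := by
  classical
  let B : Finset (Fin d → Fin (2 ^ r)) :=
    Finset.univ.filter fun k => ¬ ∃ c, ∀ x ∈ dyadicCell k, f x = c
  have hB : B.card ≤ d * (2 ^ r) ^ (d - 1) := by
    refine card_le_of_forall_not_lt hd B fun k hk l hl hlt => ?_
    have hk' := (Finset.mem_filter.1 hk).2
    have hl' := (Finset.mem_filter.1 hl).2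
    have hex : ∃ x ∈ dyadicCell k, f x = 1 := by
      by_contra! h
      exact hk' ⟨-1, fun x hx => (hf.2 x (dyadicCell_subset k hx)).resolve_right (h x hx)⟩
    obtain ⟨x, hx, hfx⟩ := hex
    refine hl' ⟨1, fun y hy => ?_⟩
    have hxc := dyadicCell_subset k hx
    have hyc := dyadicCell_subset l hy
    have hxy : x ≤ y := fun j =>
      (lt_of_mem_dyadicI (Fin.lt_def.1 (hlt j)) (l j).isLt (hx j trivial) (hy j trivial)).le
    exact le_antisymm (hf.1.1 y hyc).2 (hfx ▸ hf.1.2 x hxc y hyc hxy)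
  have hzero : ∀ k ∉ B, ∫⁻ x in dyadicCell k, G x = 0 := by
    intro k hk
    have hk' : ∃ c, ∀ x ∈ dyadicCell k, f x = c := by
      by_contra h
      exact hk (Finset.mem_filter.2 ⟨Finset.mem_univ k, h⟩)
    obtain ⟨c, hc⟩ := hk'
    rw [setLIntegral_congr_fun (measurableSet_dyadicCell k) (hconst k c hc), lintegral_zero]
  have hN : (2 ^ r : ℝ) ≠ 0 := by positivity
  calc ∫⁻ x in unitCube d, G x
      ≤ ∫⁻ x in ⋃ k : Fin d → Fin (2 ^ r), dyadicCell k, G x :=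
        lintegral_mono_set (unitCube_subset_iUnion_dyadicCell d r)
    _ ≤ ∑' k : Fin d → Fin (2 ^ r), ∫⁻ x in dyadicCell k, G x := lintegral_iUnion_le _ _
    _ = ∑ k ∈ B, ∫⁻ x in dyadicCell k, G x := by
        rw [tsum_fintype]
        exact (Finset.sum_subset (Finset.subset_univ B) fun k _ hk => hzero k hk).symm
    _ ≤ ∑ k ∈ B, ENNReal.ofReal (((2 ^ r) ^ d)⁻¹) :=
        Finset.sum_le_sum fun k _ => (hle k).trans (volume_dyadicCell k).le
    _ = ENNReal.ofReal (B.card * ((2 ^ r) ^ d)⁻¹) := by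
        rw [Finset.sum_const, nsmul_eq_mul, ENNReal.ofReal_mul (Nat.cast_nonneg _),
          ENNReal.ofReal_natCast]
    _ ≤ ENNReal.ofReal ((d * (2 ^ r) ^ (d - 1)) * ((2 ^ r) ^ d)⁻¹) := by
        refine ENNReal.ofReal_le_ofReal (mul_le_mul_of_nonneg_right ?_ (by positivity))
        exact_mod_cast hB
    _ = ENNReal.ofReal ((d : ℝ) / 2 ^ r) := by
        obtain ⟨e, rfl⟩ : ∃ e, d = e + 1 := ⟨d - 1, by omega⟩
        congr 1
        rw [Nat.add_sub_cancel, pow_succ _ e]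
        field_simp

/-- For a sign-valued monotone function `f ∈ F_mon±^d` and `r ≥ 1`, with
`f_r` the truncated Haar expansion of `f` at resolution `r`, one has
`‖f - sgn∘f_r‖_{L₁} ≤ d·2^{-r}` and `‖sgn∘f_r - f_r‖_{L₂}² ≤ d·2^{-r}`. -/
theorem statement9 (d r : ℕ) (hd : 1 ≤ d) (hr : 1 ≤ r)
    (f : (Fin d → ℝ) → ℝ) (hf : f ∈ FMonPM d) :
    dist1e f (fun x => sgn (truncExp f r x)) ≤ ENNReal.ofReal ((d : ℝ) / 2 ^ r) ∧
    (∫⁻ x in unitCube d, ENNReal.ofReal ((sgn (truncExp f r x) - truncExp f r x) ^ 2))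
      ≤ ENNReal.ofReal ((d : ℝ) / 2 ^ r) := by
  have hfi := integrableOn_of_mem_FMonPM hf
  have hV : (0 : ℝ) < (2 ^ r) ^ d := by positivity
  have hpm : ∀ k : Fin d → Fin (2 ^ r), ∀ x ∈ dyadicCell k, f x = -1 ∨ f x = 1 :=
    fun k x hx => hf.2 x (dyadicCell_subset k hx)
  have hc : ∀ (k : Fin d → Fin (2 ^ r)) (c : ℝ), (∀ x ∈ dyadicCell k, f x = c) →
      ∀ x ∈ dyadicCell k, truncExp f r x = f x := by
    intro k c hfc x hx
    rw [truncExp_eq_average hfi hx, setIntegral_congr_fun (measurableSet_dyadicCell k) hfc,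
      setIntegral_const, Measure.real, volume_dyadicCell, ENNReal.toReal_ofReal (by positivity),
      smul_eq_mul, mul_inv_cancel_left₀ hV.ne', hfc x hx]
  constructor
  · refine setLIntegral_unitCube_le hd hf (fun k c hfc x hx => ?_) fun k => ?_
    · beta_reduce
      rw [hc k c hfc x hx, sgn_of_eq_neg_one_or_one (hpm k x hx), sub_self, abs_zero,
        ENNReal.ofReal_zero]
    · have hcongr : Set.EqOn (fun x => ENNReal.ofReal |f x - sgn (truncExp f r x)|)
          (fun x => ENNReal.ofReal |f x - sgn ((2 ^ r) ^ d * ∫ y in dyadicCell k, f y)|)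
          (dyadicCell k) := fun x hx => by
        simp only [truncExp_eq_average hfi hx]
      rw [setLIntegral_congr_fun (measurableSet_dyadicCell k) hcongr]
      exact setLIntegral_abs_sub_sgn_le hV (measurableSet_dyadicCell k) (volume_dyadicCell k)
        (hpm k) (hfi.mono_set (dyadicCell_subset k))
  · refine setLIntegral_unitCube_le hd hf (fun k c hfc x hx => ?_) fun k => ?_
    · rw [hc k c hfc x hx, sgn_of_eq_neg_one_or_one (hpm k x hx), sub_self, zero_pow two_ne_zero,
        ENNReal.ofReal_zero]
    · calc ∫⁻ x in dyadicCell k, ENNReal.ofReal ((sgn (truncExp f r x) - truncExp f r x) ^ 2)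
          ≤ ∫⁻ _ in dyadicCell k, 1 := by
            refine setLIntegral_mono' (measurableSet_dyadicCell k) fun x hx => ?_
            rw [truncExp_eq_average hfi hx]
            exact ENNReal.ofReal_le_one.2 (sq_sgn_sub_le_one
              (abs_mul_setIntegral_le_one hV (volume_dyadicCell k) (hpm k)))
        _ = volume (dyadicCell k) := setLIntegral_one _

end
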